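/- Estimate of the discrete nudging term. For all fine-grid functions e and e′ and every ε > 0: −(𝓘_H e, e′)_h ≤ ε ‖e′ − 𝓘_H e′‖_h² + ε ‖e′ − e‖_h² − (1 − 1/(2ε)) ‖e′‖_h². -/

import Mathlib

/-- Discrete (cell) inner product on the uniform `N × N` grid with mesh size `h = 1/N`. -/
noncomputable def gridIP (N : ℕ) (w φ : Fin N × Fin N → ℝ) : ℝ :=
  ((1 : ℝ) / N) ^ 2 * ∑ K : Fin N × Fin N, w K * φ K

/-- Discrete squared `L²` norm. -/
noncomputable def gridNormSq (N : ℕ) (w : Fin N × Fin N → ℝ) : ℝ := gridIP N w w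

/-- Two cells are adjacent when their index pairs differ by `1` in exactly one coordinate. -/
def adjCells {N : ℕ} (K L : Fin N × Fin N) : Prop :=
  (K.1 = L.1 ∧ ((K.2 : ℕ) + 1 = (L.2 : ℕ) ∨ (L.2 : ℕ) + 1 = (K.2 : ℕ))) ∨
  (K.2 = L.2 ∧ ((K.1 : ℕ) + 1 = (L.1 : ℕ) ∨ (L.1 : ℕ) + 1 = (K.1 : ℕ)))

instance {N : ℕ} (K L : Fin N × Fin N) : Decidable (adjCells K L) := by
  unfold adjCells; infer_instance

/-- Discrete gradient inner product: sum over unordered adjacent pairs `{K, L}` of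
`(w_K − w_L)(φ_K − φ_L)`, written as half the sum over ordered pairs. -/
noncomputable def gridGradIP (N : ℕ) (w φ : Fin N × Fin N → ℝ) : ℝ :=
  (1 / 2 : ℝ) * ∑ K : Fin N × Fin N, ∑ L : Fin N × Fin N,
    if adjCells K L then (w K - w L) * (φ K - φ L) else 0

/-- Discrete squared `L²` norm of the gradient. -/
noncomputable def gridGradNormSq (N : ℕ) (w : Fin N × Fin N → ℝ) : ℝ := gridGradIP N w w

/-- Block-average observation operator `𝓘_H` (blocks of `m × m` fine cells). -/
noncomputable def obsAvg (N m : ℕ) (w : Fin N × Fin N → ℝ) : Fin N × Fin N → ℝ :=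
  fun K => (1 / (m : ℝ) ^ 2) * ∑ L : Fin N × Fin N,
    if ((L.1 : ℕ) / m = (K.1 : ℕ) / m ∧ (L.2 : ℕ) / m = (K.2 : ℕ) / m) then w L else 0


/-- The block of the cell `K`. -/
def blk (N m : ℕ) (K : Fin N × Fin N) : Finset (Fin N × Fin N) :=
  Finset.univ.filter fun L =>
    (L.1 : ℕ) / m = (K.1 : ℕ) / m ∧ (L.2 : ℕ) / m = (K.2 : ℕ) / m

lemma blk_card_le (N m : ℕ) (hm : 1 ≤ m) (K : Fin N × Fin N) : (blk N m K).card ≤ m ^ 2 := by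
  have h : (blk N m K).card ≤ (Finset.range m ×ˢ Finset.range m).card := by
    apply Finset.card_le_card_of_injOn (fun L => ((L.1 : ℕ) % m, (L.2 : ℕ) % m))
    · intro L _
      simp [Nat.mod_lt _ hm]
    · intro L hL L' hL' hEq
      simp only [blk, Finset.coe_filter, Finset.mem_univ, true_and, Set.mem_ofPred_eq] at hL hL'
      simp only [Prod.mk.injEq] at hEq
      apply Prod.ext
      · apply Fin.ext
        rw [← Nat.div_add_mod (L.1 : ℕ) m, ← Nat.div_add_mod (L'.1 : ℕ) m, hL.1, hL'.1, hEq.1]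
      · apply Fin.ext
        rw [← Nat.div_add_mod (L.2 : ℕ) m, ← Nat.div_add_mod (L'.2 : ℕ) m, hL.2, hL'.2, hEq.2]
  simpa [sq] using h

lemma obsAvg_eq (N m : ℕ) (w : Fin N × Fin N → ℝ) (K : Fin N × Fin N) :
    obsAvg N m w K = (1 / (m : ℝ) ^ 2) * ∑ L ∈ blk N m K, w L := by
  simp only [obsAvg, blk, Finset.sum_filter]

lemma obsAvg_sub (N m : ℕ) (v w : Fin N × Fin N → ℝ) (K : Fin N × Fin N) :
    obsAvg N m (v - w) K = obsAvg N m v K - obsAvg N m w K := by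
  simp only [obsAvg_eq, Pi.sub_apply, Finset.sum_sub_distrib, mul_sub]

lemma obsAvg_contract (N m : ℕ) (hm : 1 ≤ m) (w : Fin N × Fin N → ℝ) :
    ∑ K, obsAvg N m w K ^ 2 ≤ ∑ K, w K ^ 2 := by
  have hm0 : (0 : ℝ) < (m : ℝ) ^ 2 := by positivity
  have hc : ∀ K, ((blk N m K).card : ℝ) ≤ (m : ℝ) ^ 2 := fun K => by
    exact_mod_cast blk_card_le N m hm K
  have h1 : ∀ K, obsAvg N m w K ^ 2 ≤ (1 / (m : ℝ) ^ 2) * ∑ L ∈ blk N m K, w L ^ 2 := by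
    intro K
    rw [obsAvg_eq, mul_pow]
    have hcs := sq_sum_le_card_mul_sum_sq (s := blk N m K) (f := w)
    have hs : 0 ≤ ∑ L ∈ blk N m K, w L ^ 2 := Finset.sum_nonneg fun _ _ => sq_nonneg _
    have h2 := hcs.trans (mul_le_mul_of_nonneg_right (hc K) hs)
    calc _ ≤ (1 / (m : ℝ) ^ 2) ^ 2 * ((m : ℝ) ^ 2 * ∑ L ∈ blk N m K, w L ^ 2) := by gcongr
      _ = _ := by field_simp
  calc ∑ K, obsAvg N m w K ^ 2
      ≤ ∑ K, (1 / (m : ℝ) ^ 2) * ∑ L ∈ blk N m K, w L ^ 2 := Finset.sum_le_sum fun K _ => h1 K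
    _ = (1 / (m : ℝ) ^ 2) * ∑ L, ∑ K ∈ blk N m L, w L ^ 2 := by
      rw [← Finset.mul_sum]
      congr 1
      apply Finset.sum_comm'
      intro K L
      simp only [blk, Finset.mem_filter, Finset.mem_univ, true_and, and_true]
      constructor <;> rintro ⟨h, h'⟩ <;> exact ⟨h.symm, h'.symm⟩
    _ ≤ (1 / (m : ℝ) ^ 2) * ∑ L, (m : ℝ) ^ 2 * w L ^ 2 := by
      gcongr with L _
      rw [Finset.sum_const, nsmul_eq_mul]
      exact mul_le_mul_of_nonneg_right (hc L) (sq_nonneg _)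
    _ = ∑ K, w K ^ 2 := by
      rw [← Finset.mul_sum]
      field_simp

lemma young_aux (a b ε : ℝ) (hε : 0 < ε) : a * b ≤ ε * a ^ 2 + 1 / (4 * ε) * b ^ 2 := by
  have : ε * a ^ 2 + 1 / (4 * ε) * b ^ 2 - a * b = (2 * ε * a - b) ^ 2 / (4 * ε) := by
    field_simp
    ring
  have h2 : 0 ≤ (2 * ε * a - b) ^ 2 / (4 * ε) := by positivity
  linarith

/-- Estimate of the discrete nudging term. -/
theorem discrete_nudging_term_estimate (N m M : ℕ) (hm : 1 ≤ m) (hM : 1 ≤ M)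
    (hN : N = m * M) (e e' : Fin N × Fin N → ℝ) (ε : ℝ) (hε : 0 < ε) :
    -(gridIP N (obsAvg N m e) e') ≤
      ε * gridNormSq N (e' - obsAvg N m e') + ε * gridNormSq N (e' - e)
        - (1 - 1 / (2 * ε)) * gridNormSq N e' := by
  have hc := obsAvg_contract N m hm (e' - e)
  have key : -(∑ K, obsAvg N m e K * e' K) ≤
      ε * (∑ K, (e' - obsAvg N m e') K * (e' - obsAvg N m e') K)
        + ε * (∑ K, obsAvg N m (e' - e) K ^ 2)
        - (1 - 1 / (2 * ε)) * ∑ K, e' K * e' K := by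
    simp only [Finset.mul_sum, ← Finset.sum_neg_distrib, ← Finset.sum_add_distrib,
      ← Finset.sum_sub_distrib]
    apply Finset.sum_le_sum
    intro K _
    have y1 := young_aux (e' K - obsAvg N m e' K) (e' K) ε hε
    have y2 := young_aux (obsAvg N m e' K - obsAvg N m e K) (e' K) ε hε
    rw [obsAvg_sub, Pi.sub_apply]
    have h4 : 1 / (2 * ε) = 1 / (4 * ε) + 1 / (4 * ε) := by
      field_simp
      norm_num
    rw [h4]
    linarith
  have key2 : -(∑ K, obsAvg N m e K * e' K) ≤
      ε * (∑ K, (e' - obsAvg N m e') K * (e' - obsAvg N m e') K)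
        + ε * (∑ K, (e' - e) K * (e' - e) K)
        - (1 - 1 / (2 * ε)) * ∑ K, e' K * e' K := by
    have h5 := mul_le_mul_of_nonneg_left hc hε.le
    simp only [← sq] at key h5 ⊢
    linarith
  have h6 := mul_le_mul_of_nonneg_left key2 (sq_nonneg ((1 : ℝ) / N))
  simp only [gridNormSq, gridIP]
  linarith
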